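/- Let B be a Banach space with predual B_*, ν_1,…,ν_n ∈ B_* linearly independent, y ∈ ℝⁿ \ {0}, and suppose ν̂ ∈ span{ν_j} satisfies (‖ν̂‖_{B_*} ∂‖·‖_{B_*}(ν̂)) ∩ M_y ≠ ∅. Then every extreme point f̂ of the solution set S(y) of the MNI problem can be written as f̂ = Σ_{j=1}^{n} γ_j u_j with γ_j ≥ 0, Σ_j γ_j = ‖ν̂‖_{B_*}, and each u_j an extreme point of ∂‖·‖_{B_*}(ν̂). -/

import Mathlib

open Pointwise
open scoped Classical

/-- The subdifferential of the dual norm `‖·‖_{B_*}` at `μ ∈ P`, viewed as a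
subset of `B = P →L[ℝ] ℝ`. -/
noncomputable def subdiffDualNorm {P : Type*} [NormedAddCommGroup P] [NormedSpace ℝ P]
    (μ : P) : Set (P →L[ℝ] ℝ) :=
  if μ = 0 then Metric.closedBall 0 1 else {w | ‖w‖ = 1 ∧ w μ = ‖μ‖}

section Dubins
variable {E : Type*} [NormedAddCommGroup E] [NormedSpace ℝ E]

lemma shrink_mem {K : Set E} (hK : Convex ℝ K) {x d : E} (hx : x ∈ K) {a b : ℝ}
    (ha : 0 ≤ a) (hab : a ≤ b) (h : x + b • d ∈ K) : x + a • d ∈ K := by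
  rcases eq_or_lt_of_le (ha.trans hab) with hb | hb
  · have : a = 0 := by linarith
    simpa [this] using hx
  · have := hK.add_smul_sub_mem hx h (t := a / b) ⟨by positivity, by rw [div_le_one hb]; exact hab⟩
    rw [add_sub_cancel_left, smul_smul, div_mul_cancel₀ _ hb.ne'] at this
    exact this

/-- Directions of the minimal face of `K` at `x`. -/
def faceDir {K : Set E} (hK : Convex ℝ K) {x : E} (hx : x ∈ K) : Submodule ℝ E where
  carrier := {d | ∃ ε : ℝ, 0 < ε ∧ x + ε • d ∈ K ∧ x + ε • (-d) ∈ K}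
  zero_mem' := ⟨1, one_pos, by simpa using hx, by simpa using hx⟩
  add_mem' := by
    rintro a b ⟨ε, hε, h1, h2⟩ ⟨δ, hδ, h3, h4⟩
    have hm : 0 < min ε δ := lt_min hε hδ
    have k1 := shrink_mem hK hx hm.le (min_le_left _ _) h1
    have k2 := shrink_mem hK hx hm.le (min_le_left _ _) h2
    have k3 := shrink_mem hK hx hm.le (min_le_right _ _) h3
    have k4 := shrink_mem hK hx hm.le (min_le_right _ _) h4
    refine ⟨min ε δ / 2, by positivity, ?_, ?_⟩
    · convert hK k1 k3 (a := 1/2) (b := 1/2) (by norm_num) (by norm_num) (by norm_num) using 1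
      module
    · convert hK k2 k4 (a := 1/2) (b := 1/2) (by norm_num) (by norm_num) (by norm_num) using 1
      module
  smul_mem' := by
    rintro c a ⟨ε, hε, h1, h2⟩
    rcases lt_trichotomy c 0 with hc | hc | hc
    · have hc' : 0 < -c := by linarith
      have hc0 : c ≠ 0 := hc.ne
      refine ⟨ε / (-c), by positivity, ?_, ?_⟩
      · convert h2 using 2
        rw [smul_smul, smul_neg, ← neg_smul]; congr 1; field_simp
      · convert h1 using 2
        rw [← neg_smul, smul_smul]; congr 1; field_simp
    · exact ⟨1, one_pos, by simpa [hc] using hx, by simpa [hc] using hx⟩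
    · refine ⟨ε / c, by positivity, ?_, ?_⟩
      · convert h1 using 2
        rw [smul_smul]; congr 1; field_simp
      · convert h2 using 2
        rw [← smul_neg, smul_smul]; congr 1; field_simp

lemma mem_faceDir {K : Set E} (hK : Convex ℝ K) {x : E} (hx : x ∈ K) {d : E} :
    d ∈ faceDir hK hx ↔ ∃ ε : ℝ, 0 < ε ∧ x + ε • d ∈ K ∧ x + ε • (-d) ∈ K := Iff.rfl

lemma faceDir_mono {K : Set E} (hK : Convex ℝ K) {x z : E} (hx : x ∈ K) (hz : z ∈ K)
    (h : x - z ∈ faceDir hK hx) : faceDir hK hz ≤ faceDir hK hx := by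
  obtain ⟨ε, hε, h1, -⟩ := h
  rintro d ⟨δ, hδ, h3, h4⟩
  have e1 : 1 / (1 + ε) + ε / (1 + ε) = 1 := by field_simp
  have e2 : (1 / (1 + ε)) * (1 + ε) = 1 := by field_simp
  have e3 : (1 / (1 + ε)) * ε = ε / (1 + ε) := by field_simp
  have key : x = (1 / (1 + ε)) • (x + ε • (x - z)) + (ε / (1 + ε)) • z := by
    rw [← e3]
    have : x = ((1 / (1 + ε)) * (1 + ε)) • x := by rw [e2, one_smul]
    nth_rewrite 1 [this]
    module
  refine ⟨ε / (1 + ε) * δ, by positivity, ?_, ?_⟩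
  · convert hK h1 h3 (a := 1 / (1 + ε)) (b := ε / (1 + ε)) (by positivity) (by positivity) e1 using 1
    nth_rewrite 1 [key]
    module
  · convert hK h1 h4 (a := 1 / (1 + ε)) (b := ε / (1 + ε)) (by positivity) (by positivity) e1 using 1
    nth_rewrite 1 [key]
    module

lemma extreme_of_faceDir {K : Set E} (hK : Convex ℝ K) {x : E} (hx : x ∈ K)
    (h : faceDir hK hx = ⊥) : x ∈ K.extremePoints ℝ := by
  refine ⟨hx, ?_⟩
  rintro a ha b hb ⟨s, t, hs, ht, hst, rfl⟩
  have : b - a ∈ faceDir hK hx := by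
    have hm : 0 < min s t := lt_min hs ht
    refine ⟨min s t, hm, ?_, ?_⟩
    · apply shrink_mem hK hx hm.le (min_le_left _ _)
      convert hb using 1
      obtain rfl : t = 1 - s := by linarith
      module
    · apply shrink_mem hK hx hm.le (min_le_right _ _)
      convert ha using 1
      obtain rfl : t = 1 - s := by linarith
      module
  rw [h, Submodule.mem_bot, sub_eq_zero] at this
  subst this
  rw [← add_smul, hst, one_smul]

lemma exists_end {K : Set E} (hK : Convex ℝ K) (hc : IsClosed K) (hb : Bornology.IsBounded K)
    {x : E} (hx : x ∈ K) {d : E} (hd : d ∈ faceDir hK hx) (hd0 : d ≠ 0) :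
    ∃ t : ℝ, 0 ≤ t ∧ ∃ hz : x + t • d ∈ K, faceDir hK hz < faceDir hK hx := by
  obtain ⟨R, hR⟩ := hb.exists_norm_le
  have hdn : 0 < ‖d‖ := norm_pos_iff.2 hd0
  let T : Set ℝ := {t | 0 ≤ t ∧ x + t • d ∈ K}
  have hTc : IsClosed T := by
    apply IsClosed.inter isClosed_Ici
    exact hc.preimage (by fun_prop)
  have hTb : T ⊆ Set.Icc 0 ((R + ‖x‖) / ‖d‖) := by
    rintro t ⟨h0, h1⟩
    refine ⟨h0, ?_⟩
    rw [le_div_iff₀ hdn]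
    have h2 := hR _ h1
    have h3 : ‖t • d‖ ≤ ‖x + t • d‖ + ‖x‖ := by
      simpa using norm_sub_le (x + t • d) x
    rw [norm_smul, Real.norm_of_nonneg h0] at h3
    linarith
  have hTk : IsCompact T := isCompact_Icc.of_isClosed_subset hTc hTb
  obtain ⟨t, ⟨ht0, htK⟩, hmax⟩ := hTk.exists_isGreatest ⟨0, le_rfl, by simpa using hx⟩
  refine ⟨t, ht0, htK, lt_of_le_of_ne (faceDir_mono hK hx htK ?_) ?_⟩
  · have : x - (x + t • d) = (-t) • d := by module
    rw [this]
    exact Submodule.smul_mem _ _ hd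
  · intro he
    rw [← he] at hd
    obtain ⟨ε, hε, h1, -⟩ := hd
    have : t + ε ≤ t := hmax ⟨by positivity, by convert h1 using 1; module⟩
    linarith

lemma exists_extreme {K : Set E} (hK : Convex ℝ K) (hc : IsClosed K)
    (hb : Bornology.IsBounded K) (m : ℕ) : ∀ {x : E} (hx : x ∈ K)
    [FiniteDimensional ℝ (faceDir hK hx)], Module.finrank ℝ (faceDir hK hx) ≤ m →
    ∃ e ∈ K.extremePoints ℝ, x - e ∈ faceDir hK hx := by
  induction m with
  | zero =>
    intro x hx _ h
    refine ⟨x, extreme_of_faceDir hK hx ?_, by simp⟩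
    exact Submodule.finrank_eq_zero.1 (by omega)
  | succ m ih =>
    intro x hx _ h
    by_cases h0 : faceDir hK hx = ⊥
    · exact ⟨x, extreme_of_faceDir hK hx h0, by simp⟩
    obtain ⟨d, hd, hd0⟩ := Submodule.exists_mem_ne_zero_of_ne_bot h0
    obtain ⟨t, ht, hz, hlt⟩ := exists_end hK hc hb hx hd hd0
    have : FiniteDimensional ℝ (faceDir hK hz) := Submodule.finiteDimensional_of_le hlt.le
    have h1 := Submodule.finrank_lt_finrank_of_lt hlt
    obtain ⟨e, he, hze⟩ := ih hz (by omega)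
    refine ⟨e, he, ?_⟩
    have : x - e = (-t) • d + (x + t • d - e) := by module
    rw [this]
    exact Submodule.add_mem _ (Submodule.smul_mem _ _ hd) (hlt.le hze)

lemma dubins {K : Set E} (hK : Convex ℝ K) (hc : IsClosed K)
    (hb : Bornology.IsBounded K) (m : ℕ) : ∀ {x : E} (hx : x ∈ K)
    [FiniteDimensional ℝ (faceDir hK hx)], Module.finrank ℝ (faceDir hK hx) ≤ m →
    ∃ (γ : Fin (m + 1) → ℝ) (u : Fin (m + 1) → E), (∀ j, 0 ≤ γ j) ∧ ∑ j, γ j = 1 ∧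
      (∀ j, u j ∈ K.extremePoints ℝ) ∧ x = ∑ j, γ j • u j := by
  induction m with
  | zero =>
    intro x hx _ h
    exact ⟨fun _ => 1, fun _ => x, by simp, by simp,
      fun _ => extreme_of_faceDir hK hx (Submodule.finrank_eq_zero.1 (by omega)), by simp⟩
  | succ m ih =>
    intro x hx _ h
    obtain ⟨e, he, hxe⟩ := exists_extreme hK hc hb _ hx h
    by_cases h0 : x - e = 0
    · rw [sub_eq_zero] at h0
      subst h0
      refine ⟨Fin.cons 1 0, fun _ => x, ?_, ?_, fun _ => he, ?_⟩
      · intro j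
        refine Fin.cases ?_ (fun i => ?_) j <;> simp
      · simp [Fin.sum_univ_succ]
      · simp [Fin.sum_univ_succ]
    obtain ⟨t, ht, hz, hlt⟩ := exists_end hK hc hb hx hxe h0
    have : FiniteDimensional ℝ (faceDir hK hz) := Submodule.finiteDimensional_of_le hlt.le
    have h1 := Submodule.finrank_lt_finrank_of_lt hlt
    obtain ⟨γ, u, hγ, hs, hu, hzu⟩ := ih hz (by omega)
    have e2 : (1 / (1 + t)) * (1 + t) = 1 := by field_simp
    refine ⟨Fin.cons (1 / (1 + t) * t) (fun j => 1 / (1 + t) * γ j), Fin.cons e u, ?_, ?_, ?_, ?_⟩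
    · intro j
      refine Fin.cases ?_ (fun i => ?_) j
      · simp only [Fin.cons_zero]; positivity
      · simp only [Fin.cons_succ]; exact mul_nonneg (by positivity) (hγ i)
    · rw [Fin.sum_univ_succ]
      simp only [Fin.cons_zero, Fin.cons_succ, ← Finset.mul_sum, hs]
      linarith
    · intro j
      refine Fin.cases ?_ (fun i => ?_) j
      · simpa using he
      · simpa using hu i
    · rw [Fin.sum_univ_succ]
      simp only [Fin.cons_zero, Fin.cons_succ, mul_smul, ← Finset.smul_sum, ← hzu]
      have : x = ((1 / (1 + t)) * (1 + t)) • x := by rw [e2, one_smul]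
      nth_rewrite 1 [this]
      module

end Dubins

/-- Explicit representer theorem for MNI: every extreme point of the solution
set `S(y)` is a combination `∑ γ_j u_j` with `γ_j ≥ 0`, `∑ γ_j = ‖ν'‖_{B_*}`
and `u_j` extreme points of `∂‖·‖_{B_*}(ν')`. -/
theorem stmt_10 {P : Type*} [NormedAddCommGroup P] [NormedSpace ℝ P] [CompleteSpace P]
    {n : ℕ} (ν : Fin n → P) (hν : LinearIndependent ℝ ν)
    (y : Fin n → ℝ) (hy : y ≠ 0) (ν' : P)
    (hν'V : ν' ∈ Submodule.span ℝ (Set.range ν))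
    (hne : ((‖ν'‖ • subdiffDualNorm ν') ∩ {f : P →L[ℝ] ℝ | ∀ j, f (ν j) = y j}).Nonempty) :
    ∀ f ∈ ({f : P →L[ℝ] ℝ | (∀ j, f (ν j) = y j) ∧
        ∀ g : P →L[ℝ] ℝ, (∀ j, g (ν j) = y j) → ‖f‖ ≤ ‖g‖}.extremePoints ℝ),
      ∃ (γ : Fin n → ℝ) (u : Fin n → (P →L[ℝ] ℝ)),
        (∀ j, 0 ≤ γ j) ∧ (∑ j, γ j = ‖ν'‖) ∧
        (∀ j, u j ∈ (subdiffDualNorm ν').extremePoints ℝ) ∧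
        f = ∑ j, γ j • u j := by
  have hν0 : ν' ≠ 0 := by
    rintro rfl
    obtain ⟨f, ⟨w, -, rfl⟩, hf⟩ := hne
    apply hy
    funext j
    have := hf j
    simpa using this.symm
  have hN : 0 < ‖ν'‖ := norm_pos_iff.2 hν0
  have hmem : ∀ w : P →L[ℝ] ℝ, w ∈ subdiffDualNorm ν' ↔ ‖w‖ ≤ 1 ∧ w ν' = ‖ν'‖ := by
    intro w
    simp only [subdiffDualNorm, if_neg hν0, Set.mem_ofPred_eq]
    refine ⟨fun h => ⟨h.1.le, h.2⟩, fun h => ⟨le_antisymm h.1 ?_, h.2⟩⟩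
    have h1 := w.le_opNorm ν'
    rw [h.2, norm_norm] at h1
    exact le_of_mul_le_mul_right (by linarith) hN
  have hset : subdiffDualNorm ν' = Metric.closedBall (0 : P →L[ℝ] ℝ) 1 ∩ {w | w ν' = ‖ν'‖} := by
    ext w
    rw [hmem]
    simp
  have hlin : IsLinearMap ℝ (fun w : P →L[ℝ] ℝ => w ν') := ⟨fun _ _ => rfl, fun _ _ => rfl⟩
  have hK : Convex ℝ (subdiffDualNorm ν') := by
    rw [hset]
    exact (convex_closedBall _ _).inter (convex_hyperplane hlin _)
  have hc : IsClosed (subdiffDualNorm ν') := by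
    rw [hset]
    exact Metric.isClosed_closedBall.inter
      (isClosed_eq (ContinuousLinearMap.apply ℝ ℝ ν').continuous continuous_const)
  have hb : Bornology.IsBounded (subdiffDualNorm ν') := by
    rw [hset]
    exact Metric.isBounded_closedBall.subset Set.inter_subset_left
  obtain ⟨c, hcν⟩ := (Submodule.mem_span_range_iff_exists_fun ℝ).1 hν'V
  have hval : ∀ g : P →L[ℝ] ℝ, g ν' = ∑ j, c j * g (ν j) := by
    intro g
    rw [← hcν]
    simp
  obtain ⟨f0, ⟨w0, hw0, rfl⟩, hf0⟩ := hne
  have hf0 : ∀ j, (‖ν'‖ • w0) (ν j) = y j := hf0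
  rw [hmem] at hw0
  have hMval : ∀ g : P →L[ℝ] ℝ, (∀ j, g (ν j) = y j) → g ν' = ‖ν'‖ * ‖ν'‖ := by
    intro g hg
    have h1 : (‖ν'‖ • w0) ν' = ‖ν'‖ * ‖ν'‖ := by simp [hw0.2]
    rw [← h1, hval g, hval (‖ν'‖ • w0)]
    simp only [hg, hf0]
  have hf0n : ‖‖ν'‖ • w0‖ ≤ ‖ν'‖ := by
    rw [norm_smul, norm_norm]
    nlinarith [hw0.1]
  have hMn : ∀ g : P →L[ℝ] ℝ, (∀ j, g (ν j) = y j) → ‖ν'‖ ≤ ‖g‖ := by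
    intro g hg
    have h1 := g.le_opNorm ν'
    rw [hMval g hg, Real.norm_of_nonneg (by positivity)] at h1
    exact le_of_mul_le_mul_right h1 hN
  rintro f ⟨⟨hfy, hfmin⟩, hfext⟩
  have hfn : ‖f‖ ≤ ‖ν'‖ := (hfmin _ hf0).trans hf0n
  have hx : ‖ν'‖⁻¹ • f ∈ subdiffDualNorm ν' := by
    rw [hmem]
    constructor
    · rw [norm_smul, norm_inv, norm_norm, inv_mul_le_iff₀ hN]
      linarith
    · have : (‖ν'‖⁻¹ • f) ν' = ‖ν'‖⁻¹ * f ν' := rfl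
      rw [this, hMval f hfy]
      field_simp
  -- membership in the solution set of perturbations
  have hpert : ∀ (d : P →L[ℝ] ℝ) (ε : ℝ), (∀ j, d (ν j) = 0) →
      ‖ν'‖⁻¹ • f + ε • d ∈ subdiffDualNorm ν' →
      f + (‖ν'‖ * ε) • d ∈ {f : P →L[ℝ] ℝ | (∀ j, f (ν j) = y j) ∧
        ∀ g : P →L[ℝ] ℝ, (∀ j, g (ν j) = y j) → ‖f‖ ≤ ‖g‖} := by
    intro d ε hd h
    refine ⟨fun j => by simp [hd, hfy], fun g hg => le_trans ?_ (hMn g hg)⟩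
    rw [hmem] at h
    have : f + (‖ν'‖ * ε) • d = ‖ν'‖ • (‖ν'‖⁻¹ • f + ε • d) := by
      rw [smul_add, smul_smul, mul_inv_cancel₀ hN.ne', one_smul, mul_smul]
    rw [this, norm_smul, norm_norm]
    nlinarith [h.1]
  let L : faceDir hK hx →ₗ[ℝ] (Fin n → ℝ) :=
    { toFun := fun d j => d.1 (ν j)
      map_add' := fun _ _ => rfl
      map_smul' := fun _ _ => rfl }
  have hinj : Function.Injective L := by
    rw [← LinearMap.ker_eq_bot, LinearMap.ker_eq_bot']
    rintro ⟨d, hd⟩ hLd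
    have hd0 : ∀ j, d (ν j) = 0 := fun j => congrFun hLd j
    obtain ⟨ε, hε, h1, h2⟩ := hd
    have k1 := hpert d ε hd0 h1
    have k2 := hpert (-d) ε (fun j => by simp [hd0]) h2
    have := hfext k1 k2 ⟨1/2, 1/2, by norm_num, by norm_num, by norm_num, by module⟩
    have h3 : (‖ν'‖ * ε) • d = 0 := by simpa using this
    ext1
    exact (smul_eq_zero.1 h3).resolve_left (by positivity)
  have hfd : FiniteDimensional ℝ (faceDir hK hx) := FiniteDimensional.of_injective L hinj
  have hrange : LinearMap.range L < ⊤ := by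
    rw [lt_top_iff_ne_top]
    intro htop
    have : ∃ i, c i ≠ 0 := by
      by_contra! h
      apply hν0
      rw [← hcν]
      simp [h]
    obtain ⟨i, hi⟩ := this
    obtain ⟨⟨d, hd⟩, hLd⟩ := LinearMap.range_eq_top.1 htop (Pi.single i 1)
    have hdj : ∀ j, d (ν j) = (Pi.single i 1 : Fin n → ℝ) j := fun j => congrFun hLd j
    obtain ⟨ε, hε, h1, h2⟩ := hd
    rw [hmem] at h1 hx
    have h3 : (‖ν'‖⁻¹ • f) ν' + ε * d ν' = ‖ν'‖ := h1.2
    rw [hx.2] at h3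
    have h4 : ε * d ν' = 0 := by linarith
    have h5 : d ν' = 0 := (mul_eq_zero.1 h4).resolve_left hε.ne'
    rw [hval d] at h5
    simp only [hdj] at h5
    apply hi
    simpa [Pi.single_apply] using h5
  have hrk : Module.finrank ℝ (faceDir hK hx) < n := by
    have := Submodule.finrank_lt hrange.ne
    rw [LinearMap.finrank_range_of_inj hinj] at this
    simpa using this
  obtain ⟨m, rfl⟩ : ∃ m, n = m + 1 := ⟨n - 1, by omega⟩
  obtain ⟨γ, u, hγ, hs, hu, hxu⟩ := dubins hK hc hb m hx (by omega)
  refine ⟨fun j => ‖ν'‖ * γ j, u, fun j => mul_nonneg hN.le (hγ j), ?_, hu, ?_⟩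
  · rw [← Finset.mul_sum, hs, mul_one]
  · simp only [mul_smul]
    rw [← Finset.smul_sum, ← hxu, smul_smul, mul_inv_cancel₀ hN.ne', one_smul]
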